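/- For every n ≥ 7: ZC1(Li_n) < ZC1(PC(1^{n−3}, 2)) < ZC1(PC(1^{n−4}, 2, 1)) < ZC1(PC(1^{n−5}, 2, 1, 1)), and moreover ZC1(PC(1^{n−5}, 2, 1, 1)) = ZC1(PC(1^i, 2, 1^{n−3−i})) for every integer i with ⌊(n−2)/2⌋ ≤ i ≤ n − 6. -/

import Mathlib

noncomputable section
open scoped Classical
open Finset

/-- Taxicab (L¹) distance between two lattice points. -/
def taxicab (u v : ℤ × ℤ) : ℕ := (u.1 - v.1).natAbs + (u.2 - v.2).natAbs

/-- `c 0, …, c (n-1)` are the lower-left corners of the `n` unit squares of a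
polyomino chain: the cells are pairwise distinct and two cells share a common
edge (i.e. their lower-left corners are at taxicab distance 1) iff they are
consecutive in the chain, so that the centers of the squares form a path. -/
def IsPolyominoChain (n : ℕ) (c : ℕ → ℤ × ℤ) : Prop :=
  (∀ i j, i < n → j < n → c i = c j → i = j) ∧
  (∀ i j, i < n → j < n → (taxicab (c i) (c j) = 1 ↔ (i = j + 1 ∨ j = i + 1)))

/-- `v` is a corner of the unit square with lower-left corner `s`. -/
def IsSquareCorner (s v : ℤ × ℤ) : Prop :=
  v = s ∨ v = s + (1, 0) ∨ v = s + (0, 1) ∨ v = s + (1, 1)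

/-- The vertex set of the graph of a polyomino chain: all corners of its squares. -/
def corners (n : ℕ) (c : ℕ → ℤ × ℤ) : Finset (ℤ × ℤ) :=
  (Finset.range n).biUnion fun i => {c i, c i + (1, 0), c i + (0, 1), c i + (1, 1)}

/-- The graph of a polyomino chain: vertices are corners of the squares, and
two corners are adjacent iff they are the endpoints of a unit side of one of
the squares of the chain. -/
def chainGraph (n : ℕ) (c : ℕ → ℤ × ℤ) : SimpleGraph (ℤ × ℤ) :=
  SimpleGraph.fromRel fun u v =>
    taxicab u v = 1 ∧ ∃ i < n, IsSquareCorner (c i) u ∧ IsSquareCorner (c i) v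

/-- `tau n c v` = number of vertices of the chain graph at graph distance exactly 2 from `v`. -/
def tau (n : ℕ) (c : ℕ → ℤ × ℤ) (v : ℤ × ℤ) : ℕ :=
  ((corners n c).filter fun u => (chainGraph n c).dist v u = 2).card

/-- First Zagreb connection index `ZC1 = ∑_{v ∈ V} τ_v²`. -/
def ZC1 (n : ℕ) (c : ℕ → ℤ × ℤ) : ℕ := ∑ v ∈ corners n c, tau n c v ^ 2

/-- Second Zagreb connection index `ZC2 = ∑_{uv ∈ E} τ_u · τ_v`
(each edge appears twice in the double sum, whence the division by 2). -/
def ZC2 (n : ℕ) (c : ℕ → ℤ × ℤ) : ℕ :=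
  (∑ u ∈ corners n c, ∑ v ∈ corners n c,
      if (chainGraph n c).Adj u v then tau n c u * tau n c v else 0) / 2

/-- The link `L_k` (for `3 ≤ k ≤ n`) of a polyomino chain: `1` if the `k`-th
square continues the current straight segment, `2` if it is attached at a kink. -/
def link (c : ℕ → ℤ × ℤ) (k : ℕ) : ℕ :=
  if c (k - 1) - c (k - 2) = c (k - 2) - c (k - 3) then 1 else 2

/-- Indicator of a proposition, as an integer. -/
def ind (P : Prop) : ℤ := if P then 1 else 0

/-- The chain `c` with `n` squares has `m` segments, of lengths `l 1, …, l m`: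
there are cut positions `2 = k 0 < k 1 < ⋯ < k (m-1) < k m = n+1` such that the
kink links (links equal to 2) are exactly at positions `k 1, …, k (m-1)`, and the
`j`-th segment has length `l j = k j - k (j-1) + 1`. -/
def HasSegments (n : ℕ) (c : ℕ → ℤ × ℤ) (m : ℕ) (l : ℕ → ℕ) : Prop :=
  ∃ k : ℕ → ℕ, k 0 = 2 ∧ k m = n + 1 ∧
    (∀ j, 1 ≤ j → j ≤ m → k (j - 1) < k j) ∧
    (∀ x, 3 ≤ x → x ≤ n → (link c x = 2 ↔ ∃ j, 1 ≤ j ∧ j ≤ m - 1 ∧ k j = x)) ∧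
    (∀ j, 1 ≤ j → j ≤ m → l j = k j - k (j - 1) + 1)

/-- The chain `c` with `n` squares has link sequence `L_3, …, L_n`. -/
def HasLinks (n : ℕ) (c : ℕ → ℤ × ℤ) (L : ℕ → ℕ) : Prop :=
  ∀ k, 3 ≤ k → k ≤ n → link c k = L k

/-- The linear chain `Li_n` (all links equal to 1). -/
def linCell : ℕ → ℤ × ℤ := fun i => ((i : ℤ), 0)

/-- The zigzag chain `Z_n` (all links equal to 2). -/
def zigCell : ℕ → ℤ × ℤ := fun i => ((((i + 1) / 2 : ℕ) : ℤ), ((i / 2 : ℕ) : ℤ))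

lemma dist_eq_two_iff {V : Type*} (G : SimpleGraph V) (u v : V) :
    G.dist u v = 2 ↔ u ≠ v ∧ ¬ G.Adj u v ∧ ∃ w, G.Adj u w ∧ G.Adj v w := by
  have h : G.dist u v = 2 ↔ G.edist u v = 2 := by
    rw [SimpleGraph.dist]
    cases h : G.edist u v with
    | top => simp
    | coe k => simp; norm_cast
  rw [h, SimpleGraph.edist_eq_two_iff]
  rfl

lemma isSquareCorner_iff (s v : ℤ × ℤ) : IsSquareCorner s v ↔
    (v.1 = s.1 ∨ v.1 = s.1 + 1) ∧ (v.2 = s.2 ∨ v.2 = s.2 + 1) := by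
  simp only [IsSquareCorner, Prod.ext_iff, Prod.fst_add, Prod.snd_add]
  omega

lemma mem_corners (n : ℕ) (c : ℕ → ℤ × ℤ) (v : ℤ × ℤ) :
    v ∈ corners n c ↔ ∃ i < n, IsSquareCorner (c i) v := by
  simp [corners, IsSquareCorner]

lemma chainGraph_adj (n : ℕ) (c : ℕ → ℤ × ℤ) (u v : ℤ × ℤ) :
    (chainGraph n c).Adj u v ↔
      taxicab u v = 1 ∧ ∃ i < n, IsSquareCorner (c i) u ∧ IsSquareCorner (c i) v := by
  have hsymm : taxicab v u = taxicab u v := by unfold taxicab; omega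
  simp only [chainGraph, SimpleGraph.fromRel_adj, hsymm]
  constructor
  · rintro ⟨-, h | ⟨h, i, hi, hv, hu⟩⟩
    exacts [h, ⟨h, i, hi, hu, hv⟩]
  · intro h
    refine ⟨?_, Or.inl h⟩
    rintro rfl
    simp [taxicab] at h

/-- A lattice isometry matching the squares of two chains preserves `ZC1`. -/
lemma ZC1_congr {n : ℕ} {c c' : ℕ → ℤ × ℤ} (e : ℤ × ℤ ≃ ℤ × ℤ)
    (ht : ∀ u v, taxicab (e u) (e v) = taxicab u v)
    (he : ∀ i < n, ∀ v, IsSquareCorner (c' i) (e v) ↔ IsSquareCorner (c i) v) :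
    ZC1 n c' = ZC1 n c := by
  have hmem : ∀ v, e v ∈ corners n c' ↔ v ∈ corners n c := fun v => by
    simp only [mem_corners]
    exact exists_congr fun i => and_congr_right fun hi => he i hi v
  have hadj : ∀ u v, (chainGraph n c').Adj (e u) (e v) ↔ (chainGraph n c).Adj u v := fun u v => by
    simp only [chainGraph_adj, ht]
    exact and_congr_right fun _ => exists_congr fun i => and_congr_right fun hi => by
      rw [he i hi, he i hi]
  have hdist : ∀ u v, (chainGraph n c').dist (e u) (e v) = 2 ↔ (chainGraph n c).dist u v = 2 :=
    fun u v => by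
      rw [dist_eq_two_iff, dist_eq_two_iff, e.surjective.exists]
      simp only [hadj, ne_eq, e.apply_eq_iff_eq]
  have htau : ∀ v, tau n c' (e v) = tau n c v := fun v => by
    refine (card_bij (fun u _ => e u) ?_ (fun _ _ _ _ h => e.injective h) ?_).symm
    · intro u hu
      simpa [hmem, hdist] using hu
    · intro w hw
      obtain ⟨u, rfl⟩ := e.surjective w
      exact ⟨u, by simpa [hmem, hdist] using hw, rfl⟩
  refine (sum_bij (fun u _ => e u) (fun u hu => (hmem u).2 hu)
    (fun _ _ _ _ h => e.injective h) ?_ fun v _ => by rw [htau]).symm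
  intro w hw
  obtain ⟨u, rfl⟩ := e.surjective w
  exact ⟨u, (hmem u).1 hw, rfl⟩

/-- The chain with squares `(0, 0), …, (p, 0), (p, 1), (p, 2), …`. -/
def bentCell (p : ℕ) : ℕ → ℤ × ℤ := fun i => if i ≤ p then (i, 0) else (p, i - p)

/-- The isometry of the lattice taking the unit square at the origin to the unit square at `s`,
rotated so that the first axis points in the direction `(a, b)`, and reflected if `ε = -1`. -/
lemma exists_frame (s : ℤ × ℤ) (a b ε : ℤ) (hab : a.natAbs + b.natAbs = 1)
    (hε : ε = 1 ∨ ε = -1) :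
    ∃ e : ℤ × ℤ ≃ ℤ × ℤ, (∀ u v, taxicab (e u) (e v) = taxicab u v) ∧
      ∀ x y v, IsSquareCorner (s + (x * a - y * ε * b, x * b + y * ε * a)) (e v) ↔
        IsSquareCorner (x, y) v := by
  have hd : (a = 1 ∧ b = 0) ∨ (a = -1 ∧ b = 0) ∨ (a = 0 ∧ b = 1) ∨ (a = 0 ∧ b = -1) := by omega
  refine ⟨⟨fun v => (s.1 + (1 - a + ε * b) / 2 + v.1 * a - v.2 * ε * b,
      s.2 + (1 - b - ε * a) / 2 + v.1 * b + v.2 * ε * a),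
    fun w => ((w.1 - s.1 - (1 - a + ε * b) / 2) * a + (w.2 - s.2 - (1 - b - ε * a) / 2) * b,
      ((w.2 - s.2 - (1 - b - ε * a) / 2) * a - (w.1 - s.1 - (1 - a + ε * b) / 2) * b) * ε),
    ?_, ?_⟩, ?_, ?_⟩
  · rintro ⟨x, y⟩
    rcases hd with ⟨rfl, rfl⟩ | ⟨rfl, rfl⟩ | ⟨rfl, rfl⟩ | ⟨rfl, rfl⟩ <;>
      rcases hε with rfl | rfl <;> ext <;> dsimp only <;> omega
  · rintro ⟨x, y⟩
    rcases hd with ⟨rfl, rfl⟩ | ⟨rfl, rfl⟩ | ⟨rfl, rfl⟩ | ⟨rfl, rfl⟩ <;>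
      rcases hε with rfl | rfl <;> ext <;> dsimp only <;> omega
  · rintro ⟨x, y⟩ ⟨x', y'⟩
    rcases hd with ⟨rfl, rfl⟩ | ⟨rfl, rfl⟩ | ⟨rfl, rfl⟩ | ⟨rfl, rfl⟩ <;>
      rcases hε with rfl | rfl <;> simp only [taxicab, Equiv.coe_fn_mk] <;> omega
  · rintro x y ⟨x', y'⟩
    rcases hd with ⟨rfl, rfl⟩ | ⟨rfl, rfl⟩ | ⟨rfl, rfl⟩ | ⟨rfl, rfl⟩ <;>
      rcases hε with rfl | rfl <;>
      simp only [isSquareCorner_iff, Equiv.coe_fn_mk, Prod.fst_add, Prod.snd_add] <;> omega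

lemma eq_add_mul_of_straight {m : ℕ} {c : ℕ → ℤ × ℤ}
    (h : ∀ j, j + 2 ≤ m → c (j + 2) - c (j + 1) = c (j + 1) - c j) :
    ∀ j ≤ m, c j = c 0 + ((j : ℤ) * (c 1 - c 0).1, (j : ℤ) * (c 1 - c 0).2) := by
  have hstep : ∀ j, j + 1 ≤ m → c (j + 1) - c j = c 1 - c 0 := by
    intro j
    induction j with
    | zero => intro _; rfl
    | succ j ih => intro hj; rw [h j (by omega), ih (by omega)]
  intro j
  induction j with
  | zero => intro _; ext <;> simp
  | succ j ih =>
    intro hj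
    have h1 := hstep j hj
    rw [sub_eq_iff_eq_add] at h1
    rw [h1, ih (by omega)]
    ext <;> simp <;> ring

/-- A chain with at most one kink is congruent to the standard one. -/
lemma ZC1_eq_bentCell {n p q : ℕ} (hp : 1 ≤ p) (hn : n = p + q + 1) {c : ℕ → ℤ × ℤ}
    (hc : IsPolyominoChain n c) (hL : HasLinks n c fun k => if k = p + 2 then 2 else 1) :
    ZC1 n c = ZC1 n (bentCell p) := by
  have hlink : ∀ j, j + 3 ≤ n →
      (c (j + 2) - c (j + 1) = c (j + 1) - c j ↔ j + 1 ≠ p) := by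
    intro j hj
    have := hL (j + 3) (by omega) hj
    simp only [link, show j + 3 - 1 = j + 2 by omega, show j + 3 - 2 = j + 1 by omega,
      show j + 3 - 3 = j by omega] at this
    split_ifs at this <;> simp_all
  have hfst := eq_add_mul_of_straight (m := p) (c := c)
    fun j hj => (hlink j (by omega)).2 (by omega)
  have hsnd := eq_add_mul_of_straight (m := q) (c := fun j => c (p + j))
    fun j hj => (hlink (p + j) (by omega)).2 (by omega)
  have hunit : ∀ i, i + 1 < n →
      (c (i + 1) - c i).1.natAbs + (c (i + 1) - c i).2.natAbs = 1 := fun i hi =>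
    (hc.2 (i + 1) i hi (by omega)).2 (Or.inl rfl)
  have h1 := hunit 0 (by omega)
  have hdir : ∃ ε : ℤ, (ε = 1 ∨ ε = -1) ∧ (1 ≤ q →
      (c (p + 1) - c p).1 = -(ε * (c 1 - c 0).2) ∧ (c (p + 1) - c p).2 = ε * (c 1 - c 0).1) := by
    by_cases hq : 1 ≤ q
    · obtain ⟨r, rfl⟩ : ∃ r, p = r + 1 := ⟨p - 1, by omega⟩
      have h2 := hunit (r + 1) (by omega)
      have hne := (hlink r (by omega)).not.2 (by omega)
      have hne' : c (r + 2) ≠ c r := fun h => by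
        have := hc.1 _ _ (by omega) (by omega) h
        omega
      have e1 := hfst r (by omega)
      have e2 := hfst (r + 1) (by omega)
      simp only [zero_add, Prod.ext_iff, ne_eq, Prod.fst_sub, Prod.snd_sub, Prod.fst_add,
        Prod.snd_add, Nat.cast_add, Nat.cast_one, add_mul, one_mul, add_assoc, Nat.reduceAdd] at *
      by_cases h : (c (r + 2)).1 - (c (r + 1)).1 = -((c 1).2 - (c 0).2) ∧
          (c (r + 2)).2 - (c (r + 1)).2 = (c 1).1 - (c 0).1
      · exact ⟨1, Or.inl rfl, fun _ => by omega⟩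
      · exact ⟨-1, Or.inr rfl, fun _ => by omega⟩
    · exact ⟨1, Or.inl rfl, fun h => absurd h hq⟩
  obtain ⟨ε, hε, hdir⟩ := hdir
  obtain ⟨e, ht, he⟩ := exists_frame (c 0) _ _ ε h1 hε
  refine ZC1_congr e ht fun i hi v => ?_
  by_cases hip : i ≤ p
  · rw [hfst i hip, bentCell, if_pos hip, ← he i 0]
    simp
  · obtain ⟨j, rfl⟩ : ∃ j, i = p + j := ⟨i - p, by omega⟩
    obtain ⟨d1, d2⟩ := hdir (by omega)
    have hj := hsnd j (by omega)
    simp only [add_zero, d1, d2] at hj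
    rw [hfst p le_rfl] at hj
    rw [bentCell, if_neg hip, ← he p ((p + j : ℕ) - p), hj]
    apply iff_of_eq
    congr 1
    ext <;> push_cast <;> simp only [Prod.fst_add, Prod.snd_add] <;> ring

/-- The corners of the squares of `bentCell p`, when there are `p + q + 1` squares. -/
def InBent (p q : ℕ) (x y : ℤ) : Prop :=
  (0 ≤ x ∧ x ≤ p + 1 ∧ 0 ≤ y ∧ y ≤ 1) ∨ (p ≤ x ∧ x ≤ p + 1 ∧ 0 ≤ y ∧ y ≤ q + 1)

lemma isSquareCorner_bentCell (p i : ℕ) (v : ℤ × ℤ) : IsSquareCorner (bentCell p i) v ↔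
    (i ≤ p ∧ (v.1 = i ∨ v.1 = i + 1) ∧ (v.2 = 0 ∨ v.2 = 1)) ∨
    (p < i ∧ (v.1 = p ∨ v.1 = p + 1) ∧ (v.2 = i - p ∨ v.2 = i - p + 1)) := by
  rw [isSquareCorner_iff, bentCell]
  split_ifs <;> dsimp only <;> omega

lemma mem_corners_bentCell (p q : ℕ) (v : ℤ × ℤ) :
    v ∈ corners (p + q + 1) (bentCell p) ↔ InBent p q v.1 v.2 := by
  simp only [mem_corners, isSquareCorner_bentCell, InBent]
  constructor
  · rintro ⟨i, hi, h⟩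
    omega
  · intro h
    refine ⟨if v.1 < p then v.1.toNat else p + (min v.2 q).toNat, ?_, ?_⟩ <;>
    split_ifs <;> omega

lemma adj_bentCell (p q : ℕ) (u v : ℤ × ℤ) :
    (chainGraph (p + q + 1) (bentCell p)).Adj u v ↔
      taxicab u v = 1 ∧ InBent p q u.1 u.2 ∧ InBent p q v.1 v.2 := by
  rw [chainGraph_adj]
  refine and_congr_right fun ht => ?_
  constructor
  · rintro ⟨i, hi, hu, hv⟩
    exact ⟨(mem_corners_bentCell p q u).1 ((mem_corners _ _ _).2 ⟨i, hi, hu⟩),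
      (mem_corners_bentCell p q v).1 ((mem_corners _ _ _).2 ⟨i, hi, hv⟩)⟩
  · simp only [isSquareCorner_bentCell, InBent]
    simp only [taxicab] at ht
    rintro ⟨hu, hv⟩
    refine ⟨if min u.1 v.1 < p then (min u.1 v.1).toNat else p + (min (min u.2 v.2) q).toNat,
      ?_, ?_⟩ <;> split_ifs <;> omega

lemma dist_bentCell_eq_two (p q : ℕ) (u v : ℤ × ℤ) (hu : InBent p q u.1 u.2)
    (hv : InBent p q v.1 v.2) :
    (chainGraph (p + q + 1) (bentCell p)).dist u v = 2 ↔ taxicab u v = 2 := by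
  simp only [dist_eq_two_iff, adj_bentCell]
  obtain ⟨a, b⟩ := u
  obtain ⟨a', b'⟩ := v
  constructor
  · rintro ⟨hne, hadj, ⟨x, y⟩, ⟨h1, -⟩, h2, -⟩
    have h3 : ¬ taxicab (a, b) (a', b') = 1 := fun h => hadj ⟨h, hu, hv⟩
    simp only [taxicab, ne_eq, Prod.mk.injEq] at *
    omega
  · intro h
    simp only [taxicab, InBent, Prod.exists, ne_eq, Prod.mk.injEq] at *
    refine ⟨by omega, by omega, ?_⟩
    by_cases hd : a = a' ∨ b = b'
    · exact ⟨(a + a') / 2, (b + b') / 2, by omega⟩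
    · by_cases hm : InBent p q a b'
      · simp only [InBent] at hm
        exact ⟨a, b', by omega⟩
      · simp only [InBent] at hm
        exact ⟨a', b, by omega⟩

lemma tau_bentCell (p q : ℕ) (x y : ℤ) (h : InBent p q x y) :
    tau (p + q + 1) (bentCell p) (x, y) =
      (if InBent p q (x + 2) y then 1 else 0) + (if InBent p q (x - 2) y then 1 else 0) +
      (if InBent p q x (y + 2) then 1 else 0) + (if InBent p q x (y - 2) then 1 else 0) +
      (if InBent p q (x + 1) (y + 1) then 1 else 0) +
      (if InBent p q (x + 1) (y - 1) then 1 else 0) +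
      (if InBent p q (x - 1) (y + 1) then 1 else 0) +
      (if InBent p q (x - 1) (y - 1) then 1 else 0) := by
  have hset : (corners (p + q + 1) (bentCell p)).filter
      (fun u => (chainGraph (p + q + 1) (bentCell p)).dist (x, y) u = 2) =
      (({(x + 2, y), (x - 2, y), (x, y + 2), (x, y - 2), (x + 1, y + 1), (x + 1, y - 1),
        (x - 1, y + 1), (x - 1, y - 1)} : Finset (ℤ × ℤ))).filter
        fun u => InBent p q u.1 u.2 := by
    ext ⟨a, b⟩
    rw [mem_filter, mem_filter, mem_corners_bentCell, and_comm]
    refine and_congr_left fun hu => ?_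
    rw [dist_bentCell_eq_two p q _ _ h hu]
    simp only [taxicab, mem_insert, mem_singleton, Prod.mk.injEq]
    omega
  rw [tau, hset, card_filter]
  repeat rw [sum_insert (by simp only [mem_insert, mem_singleton, Prod.mk.injEq]; omega)]
  rw [sum_singleton]
  ring

lemma card_corners_bentCell (p q : ℕ) :
    (corners (p + q + 1) (bentCell p)).card = 2 * (p + q + 1) + 2 := by
  have h : corners (p + q + 1) (bentCell p) =
      (Icc (0 : ℤ) (p + 1) ×ˢ Icc (0 : ℤ) 1) ∪ (Icc (p : ℤ) (p + 1) ×ˢ Icc (2 : ℤ) (q + 1)) := by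
    ext ⟨x, y⟩
    simp only [mem_corners_bentCell, InBent, mem_union, mem_product, mem_Icc]
    omega
  rw [h, card_union_of_disjoint]
  · simp only [card_product, Int.card_Icc]
    rw [show ((p : ℤ) + 1 + 1 - 0).toNat = p + 2 by omega,
      show ((p : ℤ) + 1 + 1 - p).toNat = 2 by omega,
      show ((q : ℤ) + 1 + 1 - 2).toNat = q by omega]
    rw [show ((1 : ℤ) + 1 - 0).toNat = 2 by rfl]
    ring
  · rw [disjoint_left]
    rintro ⟨x, y⟩
    simp only [mem_product, mem_Icc]
    omega

/-- All corners outside an exceptional set `E` have connection number four. -/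
lemma ZC1_bentCell_eq (p q : ℕ) (E : Finset (ℤ × ℤ))
    (hE : ∀ v ∈ E, InBent p q v.1 v.2)
    (h4 : ∀ x y, InBent p q x y → (x, y) ∉ E → tau (p + q + 1) (bentCell p) (x, y) = 4) :
    (ZC1 (p + q + 1) (bentCell p) : ℤ) = 16 * (2 * (p + q + 1) + 2) +
      ∑ v ∈ E, ((tau (p + q + 1) (bentCell p) v : ℤ) ^ 2 - 16) := by
  have hsub : E ⊆ corners (p + q + 1) (bentCell p) := fun v hv =>
    (mem_corners_bentCell p q v).2 (hE v hv)
  rw [sum_subset hsub, sum_sub_distrib, sum_const, card_corners_bentCell, ZC1]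
  · push_cast
    simp
    ring
  · rintro ⟨x, y⟩ hv hvE
    rw [h4 x y ((mem_corners_bentCell p q _).1 hv) hvE]
    norm_num

lemma ZC1_bentCell_zero (p : ℕ) (hp : 3 ≤ p) :
    (ZC1 (p + 0 + 1) (bentCell p) : ℤ) = 16 * (2 * (p + 0 + 1) + 2) - 76 := by
  rw [ZC1_bentCell_eq p 0 {(0, 0), (0, 1), (1, 0), (1, 1), ((p : ℤ), 0),
      ((p : ℤ), 1), ((p : ℤ) + 1, 0), ((p : ℤ) + 1, 1)}]
  · repeat rw [sum_insert (by simp only [mem_insert, mem_singleton, Prod.mk.injEq]; omega)]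
    rw [sum_singleton]
    repeat rw [tau_bentCell p 0 _ _ (by unfold InBent; omega)]
    simp (disch := unfold InBent; omega) only [if_pos, if_neg]
    ring
  · simp only [mem_insert, mem_singleton, InBent, Prod.forall, Prod.mk.injEq]
    omega
  · intro x y h hE
    rw [tau_bentCell p _ _ _ h]
    simp only [mem_insert, mem_singleton, Prod.mk.injEq] at hE
    have hxy : (2 ≤ x ∧ x ≤ p - 1 ∧ y = 0) ∨ (2 ≤ x ∧ x ≤ p - 1 ∧ y = 1) := by
      unfold InBent at h
      grind
    clear h hE
    rcases hxy with h | h <;>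
      simp (disch := unfold InBent; omega) only [if_pos, if_neg]

lemma ZC1_bentCell_one (p : ℕ) (hp : 3 ≤ p) :
    (ZC1 (p + 1 + 1) (bentCell p) : ℤ) = 16 * (2 * (p + 1 + 1) + 2) - 62 := by
  rw [ZC1_bentCell_eq p 1 {(0, 0), (0, 1), (1, 0), (1, 1), ((p : ℤ) - 1, 1),
      ((p : ℤ) + 1, 0), ((p : ℤ) + 1, 1), ((p : ℤ), 2), ((p : ℤ) + 1, 2)}]
  · repeat rw [sum_insert (by simp only [mem_insert, mem_singleton, Prod.mk.injEq]; omega)]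
    rw [sum_singleton]
    repeat rw [tau_bentCell p 1 _ _ (by unfold InBent; omega)]
    simp (disch := unfold InBent; omega) only [if_pos, if_neg]
    ring
  · simp only [mem_insert, mem_singleton, InBent, Prod.forall, Prod.mk.injEq]
    omega
  · intro x y h hE
    rw [tau_bentCell p _ _ _ h]
    simp only [mem_insert, mem_singleton, Prod.mk.injEq] at hE
    have hxy : (2 ≤ x ∧ x ≤ p - 1 ∧ y = 0) ∨ (2 ≤ x ∧ x ≤ p - 2 ∧ y = 1) ∨
        (x = p ∧ y = 0) ∨ (x = p ∧ y = 1) := by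
      unfold InBent at h
      grind
    clear h hE
    rcases hxy with h | h | h | h <;>
      simp (disch := unfold InBent; omega) only [if_pos, if_neg]

lemma ZC1_bentCell_two (p : ℕ) (hp : 3 ≤ p) :
    (ZC1 (p + 2 + 1) (bentCell p) : ℤ) = 16 * (2 * (p + 2 + 1) + 2) - 58 := by
  rw [ZC1_bentCell_eq p 2 {(0, 0), (0, 1), (1, 0), (1, 1), ((p : ℤ) - 1, 1),
      ((p : ℤ), 1), ((p : ℤ) + 1, 0), ((p : ℤ) + 1, 2), ((p : ℤ), 3), ((p : ℤ) + 1, 3)}]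
  · repeat rw [sum_insert (by simp only [mem_insert, mem_singleton, Prod.mk.injEq]; omega)]
    rw [sum_singleton]
    repeat rw [tau_bentCell p 2 _ _ (by unfold InBent; omega)]
    simp (disch := unfold InBent; omega) only [if_pos, if_neg]
    ring
  · simp only [mem_insert, mem_singleton, InBent, Prod.forall, Prod.mk.injEq]
    omega
  · intro x y h hE
    rw [tau_bentCell p _ _ _ h]
    simp only [mem_insert, mem_singleton, Prod.mk.injEq] at hE
    have hxy : (2 ≤ x ∧ x ≤ p - 1 ∧ y = 0) ∨ (2 ≤ x ∧ x ≤ p - 2 ∧ y = 1) ∨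
        (x = p ∧ y = 0) ∨ (x = p ∧ y = 2) ∨ (x = p + 1 ∧ y = 1) := by
      unfold InBent at h
      grind
    clear h hE
    rcases hxy with h | h | h | h | h <;>
      simp (disch := unfold InBent; omega) only [if_pos, if_neg]

lemma ZC1_bentCell_of_three_le (p q : ℕ) (hp : 3 ≤ p) (hq : 3 ≤ q) :
    (ZC1 (p + q + 1) (bentCell p) : ℤ) = 16 * (2 * (p + q + 1) + 2) - 56 := by
  rw [ZC1_bentCell_eq p q {(0, 0), (0, 1), (1, 0), (1, 1), ((p : ℤ) - 1, 1),
      ((p : ℤ), 1), ((p : ℤ) + 1, 0), ((p : ℤ), 2), ((p : ℤ), (q : ℤ)), ((p : ℤ) + 1, (q : ℤ)),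
      ((p : ℤ), (q : ℤ) + 1), ((p : ℤ) + 1, (q : ℤ) + 1)}]
  · repeat rw [sum_insert (by simp only [mem_insert, mem_singleton, Prod.mk.injEq]; omega)]
    rw [sum_singleton]
    repeat rw [tau_bentCell p q _ _ (by unfold InBent; omega)]
    simp (disch := unfold InBent; omega) only [if_pos, if_neg]
    ring
  · simp only [mem_insert, mem_singleton, InBent, Prod.forall, Prod.mk.injEq]
    omega
  · intro x y h hE
    rw [tau_bentCell p _ _ _ h]
    simp only [mem_insert, mem_singleton, Prod.mk.injEq] at hE
    have hxy : (2 ≤ x ∧ x ≤ p - 1 ∧ y = 0) ∨ (2 ≤ x ∧ x ≤ p - 2 ∧ y = 1) ∨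
        (x = p ∧ y = 0) ∨ (x = p ∧ 3 ≤ y ∧ y ≤ q - 1) ∨ (x = p + 1 ∧ y = 1) ∨
        (x = p + 1 ∧ 2 ≤ y ∧ y ≤ q - 1) := by
      unfold InBent at h
      grind
    clear h hE
    rcases hxy with h | h | h | h | h | h <;>
      simp (disch := unfold InBent; omega) only [if_pos, if_neg]

/-- **Proposition 2.9 (increasing part).** For `n ≥ 7`:
`ZC1(Li_n) < ZC1(PC(1^{n-3},2)) < ZC1(PC(1^{n-4},2,1)) < ZC1(PC(1^{n-5},2,1,1))`,
and `ZC1(PC(1^{n-5},2,1,1)) = ZC1(PC(1^i,2,1^{n-3-i}))` for every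
`⌊(n-2)/2⌋ ≤ i ≤ n - 6`. -/
theorem ZC1_single_kink_chains
    (n : ℕ) (hn : 7 ≤ n)
    (cLi cA cB cC : ℕ → ℤ × ℤ)
    (hcLi : IsPolyominoChain n cLi) (hcA : IsPolyominoChain n cA)
    (hcB : IsPolyominoChain n cB) (hcC : IsPolyominoChain n cC)
    (hLLi : HasLinks n cLi fun _ => 1)
    (hLA : HasLinks n cA fun k => if k = n then 2 else 1)
    (hLB : HasLinks n cB fun k => if k = n - 1 then 2 else 1)
    (hLC : HasLinks n cC fun k => if k = n - 2 then 2 else 1) :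
    ZC1 n cLi < ZC1 n cA ∧ ZC1 n cA < ZC1 n cB ∧ ZC1 n cB < ZC1 n cC ∧
    ∀ i : ℕ, (n - 2) / 2 ≤ i → i ≤ n - 6 →
      ∀ cD : ℕ → ℤ × ℤ, IsPolyominoChain n cD →
        HasLinks n cD (fun k => if k = i + 3 then 2 else 1) →
        ZC1 n cC = ZC1 n cD := by
  have eLi := ZC1_eq_bentCell (p := n - 1) (q := 0) (by omega) (by omega) hcLi
    fun k hk hkn => (hLLi k hk hkn).trans (if_neg (by omega)).symm
  have eA := ZC1_eq_bentCell (p := n - 2) (q := 1) (by omega) (by omega) hcA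
    (by rwa [show n - 2 + 2 = n by omega])
  have eB := ZC1_eq_bentCell (p := n - 3) (q := 2) (by omega) (by omega) hcB
    (by rwa [show n - 3 + 2 = n - 1 by omega])
  have eC := ZC1_eq_bentCell (p := n - 4) (q := 3) (by omega) (by omega) hcC
    (by rwa [show n - 4 + 2 = n - 2 by omega])
  have vLi := ZC1_bentCell_zero (n - 1) (by omega)
  have vA := ZC1_bentCell_one (n - 2) (by omega)
  have vB := ZC1_bentCell_two (n - 3) (by omega)
  have vC := ZC1_bentCell_of_three_le (n - 4) 3 (by omega) le_rfl
  rw [show n - 1 + 0 + 1 = n by omega] at vLi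
  rw [show n - 2 + 1 + 1 = n by omega] at vA
  rw [show n - 3 + 2 + 1 = n by omega] at vB
  rw [show n - 4 + 3 + 1 = n by omega] at vC
  refine ⟨by omega, by omega, by omega, fun i hi hi' cD hcD hLD => ?_⟩
  have eD := ZC1_eq_bentCell (p := i + 1) (q := n - 2 - i) (by omega) (by omega) hcD hLD
  have vD := ZC1_bentCell_of_three_le (i + 1) (n - 2 - i) (by omega) (by omega)
  rw [show i + 1 + (n - 2 - i) + 1 = n by omega] at vD
  omega
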